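/- For every integer t ≥ 1 and n = 4t² + 1, there exists an outerplanar graph G of order n with ψ(G) = ψ_s(G) = ⌊√(4n − 23/4) + 1/2⌋ = 4t. -/

import Mathlib

open SimpleGraph

/-- A graph is planar if it has a drawing in the plane: vertices map injectively to points,
edges map to arcs between their endpoints, arc interiors avoid vertex images, and the
interiors of arcs of distinct edges are disjoint. -/
def SimpleGraph.IsPlanar {V : Type*} (G : SimpleGraph V) : Prop :=
  ∃ f : V → ℝ × ℝ, Function.Injective f ∧
    ∃ γ : ∀ ⦃u v : V⦄, G.Adj u v → _root_.Path (f u) (f v),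
      (∀ ⦃u v : V⦄ (h : G.Adj u v), Function.Injective (γ h)) ∧
      (∀ ⦃u v : V⦄ (h : G.Adj u v) (t : unitInterval), t ≠ 0 → t ≠ 1 → ∀ w, γ h t ≠ f w) ∧
      (∀ ⦃u v u' v' : V⦄ (h : G.Adj u v) (h' : G.Adj u' v'), s(u, v) ≠ s(u', v') →
        ∀ s t : unitInterval, s ≠ 0 → s ≠ 1 → γ h s ≠ γ h' t)

/-- The cone over `G`: a new vertex `none` joined to every vertex of `G`. -/
def SimpleGraph.cone {V : Type*} (G : SimpleGraph V) : SimpleGraph (Option V) :=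
  SimpleGraph.fromRel
    (fun x y => (∃ u v, x = some u ∧ y = some v ∧ G.Adj u v) ∨ x = none)

/-- A graph is outerplanar iff the cone over it is planar. -/
def SimpleGraph.IsOuterplanar {V : Type*} (G : SimpleGraph V) : Prop :=
  G.cone.IsPlanar

/-- A complete `k`-coloring: surjective, and every pair of distinct colors appears on an edge. -/
def SimpleGraph.IsCompleteColoring {V : Type*} {k : ℕ} (G : SimpleGraph V)
    (c : V → Fin k) : Prop :=
  Function.Surjective c ∧
    ∀ i j : Fin k, i ≠ j → ∃ u v, G.Adj u v ∧ c u = i ∧ c v = j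

/-- A proper coloring: adjacent vertices receive distinct colors. -/
def SimpleGraph.IsProperColoring {V : Type*} {k : ℕ} (G : SimpleGraph V)
    (c : V → Fin k) : Prop :=
  ∀ ⦃u v : V⦄, G.Adj u v → c u ≠ c v

/-- The pseudoachromatic number: the largest `k` admitting a complete `k`-coloring. -/
noncomputable def SimpleGraph.pseudoachromatic {V : Type*} (G : SimpleGraph V) : ℕ :=
  sSup {k | ∃ c : V → Fin k, G.IsCompleteColoring c}

/-- The achromatic number: the largest `k` admitting a proper complete `k`-coloring. -/
noncomputable def SimpleGraph.achromatic {V : Type*} (G : SimpleGraph V) : ℕ :=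
  sSup {k | ∃ c : V → Fin k, G.IsProperColoring c ∧ G.IsCompleteColoring c}

/-- The chromatic number: the least `k` admitting a proper `k`-coloring. -/
noncomputable def SimpleGraph.chromNum {V : Type*} (G : SimpleGraph V) : ℕ :=
  sInf {k | ∃ c : V → Fin k, G.IsProperColoring c}

/-- The thickness: the least number of planar subgraphs whose union is `G`. -/
noncomputable def SimpleGraph.thickness {V : Type*} (G : SimpleGraph V) : ℕ :=
  sInf {k | ∃ f : Fin k → SimpleGraph V, (∀ i, (f i).IsPlanar) ∧ (⨆ i, f i) = G}

/-- The outerthickness: the least number of outerplanar subgraphs whose union is `G`. -/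
noncomputable def SimpleGraph.outerthickness {V : Type*} (G : SimpleGraph V) : ℕ :=
  sInf {k | ∃ f : Fin k → SimpleGraph V, (∀ i, (f i).IsOuterplanar) ∧ (⨆ i, f i) = G}

/-- The 4-girth-thickness: the least number of planar subgraphs of girth at least 4
whose union is `G`. -/
noncomputable def SimpleGraph.girth4Thickness {V : Type*} (G : SimpleGraph V) : ℕ :=
  sInf {k | ∃ f : Fin k → SimpleGraph V,
    (∀ i, (f i).IsPlanar ∧ 4 ≤ (f i).egirth) ∧ (⨆ i, f i) = G}
/-- No two edges cross when the vertices are placed on a line in their order and the edges are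
drawn on one side of the line. -/
def SimpleGraph.IsNoncrossing {V : Type*} [LT V] (G : SimpleGraph V) : Prop :=
  ∀ ⦃a b c d : V⦄, G.Adj a b → G.Adj c d → a < c → c < b → b < d → False

namespace OnePageDrawing

/-- Vertices of the graph lie on the `x`-axis, the apex of the cone lies below it. -/
noncomputable def point {n : ℕ} : Option (Fin n) → ℝ × ℝ
  | none => (-1, -1)
  | some v => ((v : ℝ), 0)

/-- Edges between vertices are parabolic arcs, edges at the apex are segments. -/
noncomputable def arc {n : ℕ} : Option (Fin n) → Option (Fin n) → ℝ → ℝ × ℝ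
  | none, none, _ => (-1, -1)
  | none, some v, s => (-1 + s * (v + 1), -1 + s)
  | some v, none, s => (-1 + (1 - s) * (v + 1), -s)
  | some u, some v, s => (u + s * (v - u), s * (1 - s) * ((v : ℝ) - u) ^ 2)

theorem continuous_arc {n : ℕ} (x y : Option (Fin n)) : Continuous (arc x y) := by
  rcases x with _ | u <;> rcases y with _ | v
  · exact continuous_const
  · change Continuous fun s : ℝ => (-1 + s * ((v : ℝ) + 1), -1 + s)
    fun_prop
  · change Continuous fun s : ℝ => (-1 + (1 - s) * ((u : ℝ) + 1), -s)
    fun_prop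
  · change Continuous fun s : ℝ => ((u : ℝ) + s * (v - u), s * (1 - s) * ((v : ℝ) - u) ^ 2)
    fun_prop

/-- The arc between two points as a path. -/
noncomputable def arcPath {n : ℕ} (x y : Option (Fin n)) : _root_.Path (point x) (point y) where
  toFun s := arc x y s
  continuous_toFun := (continuous_arc x y).comp continuous_subtype_val
  source' := by rcases x with _ | u <;> rcases y with _ | v <;> simp [arc, point]
  target' := by rcases x with _ | u <;> rcases y with _ | v <;> simp [arc, point]

theorem point_injective {n : ℕ} : Function.Injective (point (n := n)) := by
  rintro (_ | u) (_ | v) h <;> simp_all [point, Fin.ext_iff]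

theorem arc_injective {n : ℕ} {x y : Option (Fin n)} (hxy : x ≠ y) :
    Function.Injective (arc x y) := by
  intro s t h
  rcases x with _ | u <;> rcases y with _ | v
  · exact absurd rfl hxy
  · simpa [arc] using congrArg Prod.snd h
  · simpa [arc] using congrArg Prod.snd h
  · have huv : (v : ℝ) - u ≠ 0 := by
      rw [sub_ne_zero]
      simpa [Fin.ext_iff, eq_comm] using hxy
    simpa [arc, huv] using congrArg Prod.fst h

theorem arc_snd_pos {n : ℕ} {u v : Fin n} (huv : u ≠ v) {s : ℝ} (h0 : 0 < s) (h1 : s < 1) :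
    0 < (arc (some u) (some v) s).2 := by
  have huv : (v : ℝ) - u ≠ 0 := by
    rw [sub_ne_zero]
    simpa [Fin.ext_iff, eq_comm] using huv
  have : 0 < ((v : ℝ) - u) ^ 2 := by positivity
  have : 0 < 1 - s := by linarith
  simp only [arc]
  positivity

theorem arc_ne_point {n : ℕ} {x y : Option (Fin n)} (hxy : x ≠ y) {s : ℝ} (h0 : 0 < s)
    (h1 : s < 1) (w : Option (Fin n)) : arc x y s ≠ point w := by
  intro h
  have hs := congrArg Prod.snd h
  rcases x with _ | u <;> rcases y with _ | v
  · exact absurd rfl hxy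
  · rcases w with _ | w <;> simp only [arc, point] at hs <;> linarith
  · rcases w with _ | w <;> simp only [arc, point] at hs <;> linarith
  · have := arc_snd_pos (fun h => hxy (congrArg some h)) h0 h1
    rw [hs] at this
    rcases w with _ | w <;> simp [point] at this
    linarith

theorem eq_of_parabolas_meet {a b c d x : ℝ} (hax : a < x) (hxb : x < b) (hcx : c < x)
    (hxd : x < d) (h₁ : ¬ (a < c ∧ b < d)) (h₂ : ¬ (c < a ∧ d < b))
    (h : (x - a) * (b - x) = (x - c) * (d - x)) : a = c ∧ b = d := by
  rcases lt_trichotomy a c with hac | rfl | hac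
  · have : d ≤ b := not_lt.1 fun hbd => h₁ ⟨hac, hbd⟩
    nlinarith [mul_pos (sub_pos.2 hac) (sub_pos.2 hxb)]
  · refine ⟨rfl, ?_⟩
    have := mul_left_cancel₀ (sub_pos.2 hax).ne' h
    linarith
  · have : b ≤ d := not_lt.1 fun hbd => h₂ ⟨hac, hbd⟩
    nlinarith [mul_pos (sub_pos.2 hac) (sub_pos.2 hxd)]

theorem arc_some_ne {n : ℕ} {G : SimpleGraph (Fin n)} (hG : G.IsNoncrossing) {u v u' v' : Fin n}
    (h : G.Adj u v) (h' : G.Adj u' v') (hne : s(u, v) ≠ s(u', v')) {s t : ℝ} (hs0 : 0 < s)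
    (hs1 : s < 1) (ht0 : 0 < t) (ht1 : t < 1) :
    arc (some u) (some v) s ≠ arc (some u') (some v') t := by
  intro heq
  wlog huv : u < v generalizing u v s
  · refine this h.symm (by rwa [Sym2.eq_swap]) (s := 1 - s) (by linarith) (by linarith) ?_
      (lt_of_le_of_ne (not_lt.1 huv) h.ne')
    rw [← heq]
    ext <;> simp only [arc] <;> ring
  wlog huv' : u' < v' generalizing u' v' t
  · refine this h'.symm (t := 1 - t) (by linarith) (by linarith)
      (by rwa [Sym2.eq_swap (a := v')]) ?_ (lt_of_le_of_ne (not_lt.1 huv') h'.ne')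
    rw [heq]
    ext <;> simp only [arc] <;> ring
  have hx := congrArg Prod.fst heq
  have hy := congrArg Prod.snd heq
  simp only [arc] at hx hy
  have hlt : (u : ℝ) < v := by exact_mod_cast huv
  have hlt' : (u' : ℝ) < v' := by exact_mod_cast huv'
  have key := eq_of_parabolas_meet (a := u) (b := v) (c := u') (d := v')
    (x := u + s * (v - u)) (by nlinarith) (by nlinarith) (by rw [hx]; nlinarith)
    (by rw [hx]; nlinarith) ?_ ?_ ?_
  · refine hne ?_
    have h1 : u = u' := by ext; exact_mod_cast key.1
    have h2 : v = v' := by ext; exact_mod_cast key.2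
    rw [h1, h2]
  · rintro ⟨h1, h2⟩
    refine hG h h' (by exact_mod_cast h1) ?_ (by exact_mod_cast h2)
    have : (u' : ℝ) < v := by nlinarith
    exact_mod_cast this
  · rintro ⟨h1, h2⟩
    refine hG h' h (by exact_mod_cast h1) ?_ (by exact_mod_cast h2)
    have : (u : ℝ) < v' := by nlinarith
    exact_mod_cast this
  · have e1 : (u + s * (v - u) - u) * (v - (u + s * (v - u)))
        = s * (1 - s) * ((v : ℝ) - u) ^ 2 := by ring
    have e2 : (u' + t * (v' - u') - u') * (v' - (u' + t * (v' - u')))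
        = t * (1 - t) * ((v' : ℝ) - u') ^ 2 := by ring
    rw [e1, hx, e2, hy]

theorem arc_apex_injective {n : ℕ} {v w : Fin n} {s t : ℝ} (hs : 0 < s)
    (h : arc none (some v) s = arc none (some w) t) : v = w := by
  have hx := congrArg Prod.fst h
  have hy := congrArg Prod.snd h
  simp only [arc] at hx hy
  obtain rfl : s = t := by linarith
  have := mul_left_cancel₀ hs.ne' (add_left_cancel hx)
  ext
  exact_mod_cast add_right_cancel this

theorem arc_symm_apex {n : ℕ} (v : Fin n) (s : ℝ) :
    arc (some v) none s = arc none (some v) (1 - s) := by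
  ext <;> simp only [arc]; ring

theorem arc_apex_ne {n : ℕ} {v u w : Fin n} (huw : u ≠ w) {s t : ℝ} (hs1 : s < 1)
    (ht0 : 0 < t) (ht1 : t < 1) : arc none (some v) s ≠ arc (some u) (some w) t := by
  intro h
  have := arc_snd_pos huw ht0 ht1
  rw [← h] at this
  simp only [arc] at this
  linarith

theorem cone_adj_some {n : ℕ} {G : SimpleGraph (Fin n)} {u v : Fin n} :
    G.cone.Adj (some u) (some v) ↔ G.Adj u v := by
  simp only [SimpleGraph.cone, SimpleGraph.fromRel_adj]
  constructor
  · rintro ⟨-, (⟨a, b, ha, hb, h⟩ | h) | (⟨a, b, ha, hb, h⟩ | h)⟩ <;> simp_all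
    exact h.symm
  · intro h
    exact ⟨by simpa using h.ne, Or.inl (Or.inl ⟨u, v, rfl, rfl, h⟩)⟩

theorem arc_ne_arc {n : ℕ} {G : SimpleGraph (Fin n)} (hG : G.IsNoncrossing)
    {x y x' y' : Option (Fin n)} (h : G.cone.Adj x y) (h' : G.cone.Adj x' y')
    (hne : s(x, y) ≠ s(x', y')) {s t : ℝ} (hs0 : 0 < s)
    (hs1 : s < 1) (ht0 : 0 < t) (ht1 : t < 1) : arc x y s ≠ arc x' y' t := by
  rcases x with _ | u <;> rcases y with _ | v
  · exact absurd rfl h.ne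
  all_goals rcases x' with _ | u' <;> rcases y' with _ | v'
  all_goals first
    | exact absurd rfl h'.ne
    | skip
  · exact fun e => hne (by rw [arc_apex_injective hs0 e])
  · rw [arc_symm_apex]
    exact fun e => hne (by rw [arc_apex_injective hs0 e, Sym2.eq_swap])
  · exact arc_apex_ne (cone_adj_some.1 h').ne hs1 ht0 ht1
  · rw [arc_symm_apex]
    exact fun e => hne (by rw [arc_apex_injective (by linarith) e, Sym2.eq_swap])
  · rw [arc_symm_apex, arc_symm_apex]
    exact fun e => hne (by rw [arc_apex_injective (by linarith) e])
  · rw [arc_symm_apex]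
    exact arc_apex_ne (cone_adj_some.1 h').ne (by linarith) ht0 ht1
  · exact (arc_apex_ne (cone_adj_some.1 h).ne ht1 hs0 hs1).symm
  · rw [arc_symm_apex]
    exact (arc_apex_ne (cone_adj_some.1 h).ne (by linarith) hs0 hs1).symm
  · refine arc_some_ne hG (cone_adj_some.1 h) (cone_adj_some.1 h') (fun e => hne ?_)
      hs0 hs1 ht0 ht1
    simpa using congrArg (Sym2.map some) e

end OnePageDrawing

open OnePageDrawing in
theorem SimpleGraph.IsNoncrossing.isOuterplanar {n : ℕ} {G : SimpleGraph (Fin n)}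
    (hG : G.IsNoncrossing) : G.IsOuterplanar := by
  have pos : ∀ s : unitInterval, s ≠ 0 → 0 < (s : ℝ) := fun s hs =>
    lt_of_le_of_ne s.2.1 fun h => hs (Subtype.ext h.symm)
  have lt_one : ∀ s : unitInterval, s ≠ 1 → (s : ℝ) < 1 := fun s hs =>
    lt_of_le_of_ne s.2.2 fun h => hs (Subtype.ext h)
  refine ⟨point, point_injective, fun x y _ => arcPath x y, ?_, ?_, ?_⟩
  · intro x y h s t hst
    exact Subtype.ext (arc_injective h.ne hst)
  · intro x y h s h0 h1 w
    exact arc_ne_point h.ne (pos s h0) (lt_one s h1) w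
  · intro x y x' y' h h' hne s t hs0 hs1 hst
    rcases eq_or_ne t 0 with rfl | ht0
    · exact arc_ne_point h.ne (pos s hs0) (lt_one s hs1) x' (hst.trans (arcPath x' y').source)
    rcases eq_or_ne t 1 with rfl | ht1
    · exact arc_ne_point h.ne (pos s hs0) (lt_one s hs1) y' (hst.trans (arcPath x' y').target)
    exact arc_ne_arc hG h h' hne (pos s hs0) (lt_one s hs1) (pos t ht0) (lt_one t ht1) hst

/-- A complete `k`-coloring needs at least `k.choose 2` edges. -/
theorem SimpleGraph.IsCompleteColoring.choose_two_le {V : Type*} [Finite V] {G : SimpleGraph V}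
    {k : ℕ} {c : V → Fin k} (hc : G.IsCompleteColoring c) : k.choose 2 ≤ G.edgeSet.ncard := by
  have hsub : (⊤ : SimpleGraph (Fin k)).edgeSet ⊆ Sym2.map c '' G.edgeSet := by
    intro e
    induction e with | _ i j
    intro hij
    obtain ⟨u, v, huv, rfl, rfl⟩ := hc.2 i j hij
    exact ⟨s(u, v), huv, rfl⟩
  calc k.choose 2 = (⊤ : SimpleGraph (Fin k)).edgeSet.ncard := by
        rw [← SimpleGraph.coe_edgeFinset, Set.ncard_coe_finset,
          SimpleGraph.card_edgeFinset_top_eq_card_choose_two, Fintype.card_fin]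
    _ ≤ (Sym2.map c '' G.edgeSet).ncard := Set.ncard_le_ncard hsub (Set.toFinite _)
    _ ≤ G.edgeSet.ncard := Set.ncard_image_le (Set.toFinite _)

/-- A graph with a complete coloring has a subgraph, with one edge for each pair of colors,
whose achromatic and pseudoachromatic numbers equal the number of colors. -/
theorem SimpleGraph.exists_le_achromatic_eq {V : Type*} [Finite V] {H : SimpleGraph V} {k : ℕ}
    (hk : 2 ≤ k) {c : V → Fin k}
    (hc : ∀ i j : Fin k, i ≠ j → ∃ u v, H.Adj u v ∧ c u = i ∧ c v = j) :
    ∃ G ≤ H, G.achromatic = k ∧ G.pseudoachromatic = k := by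
  have hex : ∀ p : (⊤ : SimpleGraph (Fin k)).edgeSet, ∃ e ∈ H.edgeSet, Sym2.map c e = p := by
    rintro ⟨p, hp⟩
    induction p with | _ i j
    obtain ⟨u, v, huv, rfl, rfl⟩ := hc i j hp
    exact ⟨s(u, v), huv, rfl⟩
  choose e heH hec using hex
  set G := SimpleGraph.fromEdgeSet (Set.range e) with hG
  have hcard : G.edgeSet.ncard ≤ k.choose 2 := by
    calc G.edgeSet.ncard ≤ (Set.range e).ncard := by
          refine Set.ncard_le_ncard ?_ (Set.toFinite _)
          rw [hG, SimpleGraph.edgeSet_fromEdgeSet]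
          exact Set.sdiff_subset
      _ ≤ (Set.univ : Set (⊤ : SimpleGraph (Fin k)).edgeSet).ncard := by
          rw [← Set.image_univ]
          exact Set.ncard_image_le (Set.toFinite _)
      _ = k.choose 2 := by
          rw [Set.ncard_univ, Nat.card_coe_set_eq, ← SimpleGraph.coe_edgeFinset,
            Set.ncard_coe_finset, SimpleGraph.card_edgeFinset_top_eq_card_choose_two,
            Fintype.card_fin]
  have hle : G ≤ H := by
    intro u v huv
    rw [hG, SimpleGraph.fromEdgeSet_adj] at huv
    obtain ⟨⟨p, hp⟩, -⟩ := huv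
    have := heH p
    rwa [hp] at this
  have hproper : G.IsProperColoring c := by
    intro u v huv
    rw [hG, SimpleGraph.fromEdgeSet_adj] at huv
    obtain ⟨⟨p, hp⟩, -⟩ := huv
    have h1 := hec p
    rw [hp, Sym2.map_mk] at h1
    have h2 := p.2
    rw [← h1] at h2
    exact h2
  have hcomplete : ∀ i j : Fin k, i ≠ j → ∃ u v, G.Adj u v ∧ c u = i ∧ c v = j := by
    intro i j hij
    have h1 := hec ⟨s(i, j), hij⟩
    have h2 := heH ⟨s(i, j), hij⟩
    have h3 : e ⟨s(i, j), hij⟩ ∈ Set.range e := ⟨_, rfl⟩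
    generalize e ⟨s(i, j), hij⟩ = q at h1 h2 h3
    induction q with | _ u v
    have huv : G.Adj u v := (SimpleGraph.fromEdgeSet_adj _).2 ⟨h3, SimpleGraph.Adj.ne h2⟩
    rw [Sym2.map_mk] at h1
    rcases Sym2.eq_iff.1 h1 with ⟨hu, hv⟩ | ⟨hu, hv⟩
    · exact ⟨u, v, huv, hu, hv⟩
    · exact ⟨v, u, huv.symm, hv, hu⟩
  have hcc : G.IsCompleteColoring c := by
    refine ⟨fun i => ?_, hcomplete⟩
    have : Nontrivial (Fin k) := Fin.nontrivial_iff_two_le.2 hk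
    obtain ⟨j, hj⟩ := exists_ne i
    obtain ⟨u, -, -, hu, -⟩ := hcomplete i j hj.symm
    exact ⟨u, hu⟩
  have hub : ∀ {l : ℕ} {c' : V → Fin l}, G.IsCompleteColoring c' → l ≤ k := by
    intro l c' hc'
    by_contra! hlt
    have h1 := hc'.choose_two_le.trans hcard
    have h2 := Nat.choose_le_choose 2 (Nat.succ_le_of_lt hlt)
    rw [Nat.succ_eq_add_one, Nat.choose_succ_succ' k 1, Nat.choose_one_right] at h2
    simp only [Nat.reduceAdd] at h2
    omega
  refine ⟨G, hle, IsGreatest.csSup_eq ⟨⟨c, hproper, hcc⟩, ?_⟩,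
    IsGreatest.csSup_eq ⟨⟨c, hcc⟩, ?_⟩⟩
  · rintro l ⟨c', -, hc'⟩
    exact hub hc'
  · rintro l ⟨c', hc'⟩
    exact hub hc'

namespace FanBlocks

/-- The zigzag sequence `0, -1, 1, -2, 2, …`. -/
def zigzag (k : ℕ) : ℤ := if k % 2 = 0 then (k / 2 : ℕ) else -((k / 2 : ℕ) : ℤ) - 1

theorem natCast_add_self (t : ℕ) : (t : ZMod (2 * t)) + t = 0 := by
  have := ZMod.natCast_self (2 * t)
  push_cast at this
  linear_combination this

theorem exists_zigzag_eq {t : ℕ} (ht : 1 ≤ t) (x : ZMod (2 * t)) :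
    ∃ k < t, x = zigzag k ∨ x = zigzag k + t := by
  have : NeZero (2 * t) := ⟨by omega⟩
  obtain ⟨a, ha, rfl⟩ : ∃ a : ℕ, a < 2 * t ∧ (a : ZMod (2 * t)) = x :=
    ⟨x.val, x.val_lt, ZMod.natCast_zmod_val x⟩
  have key : ∀ r : ℤ, -(t : ℤ) ≤ 2 * r → 2 * r < t → ∃ k < t, zigzag k = r := by
    intro r h1 h2
    rcases le_or_gt 0 r with h | h
    · refine ⟨2 * r.toNat, by omega, ?_⟩
      rw [zigzag]
      split_ifs <;> omega
    · refine ⟨2 * (-r).toNat - 1, by omega, ?_⟩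
      rw [zigzag]
      split_ifs <;> omega
  by_cases h1 : 2 * (a : ℤ) < t
  · obtain ⟨k, hk, hz⟩ := key a (by omega) h1
    exact ⟨k, hk, Or.inl (by rw [hz]; simp)⟩
  by_cases h2 : 2 * ((a : ℤ) - t) < t
  · obtain ⟨k, hk, hz⟩ := key (a - t) (by omega) h2
    exact ⟨k, hk, Or.inr (by rw [hz]; simp)⟩
  · obtain ⟨k, hk, hz⟩ := key (a - 2 * t) (by omega) (by omega)
    refine ⟨k, hk, Or.inl ?_⟩
    rw [hz]
    push_cast
    linear_combination natCast_add_self t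

theorem exists_zigzag_step {t : ℕ} (ht : 1 ≤ t) {x : ZMod (2 * t)} (hx : x ≠ 0) :
    x = t ∨ ∃ k, k + 1 < t ∧
      (x = zigzag (k + 1) - zigzag k ∨ x = zigzag k - zigzag (k + 1)) := by
  have : NeZero (2 * t) := ⟨by omega⟩
  obtain ⟨a, ha, rfl⟩ : ∃ a : ℕ, a < 2 * t ∧ (a : ZMod (2 * t)) = x :=
    ⟨x.val, x.val_lt, ZMod.natCast_zmod_val x⟩
  have ha0 : a ≠ 0 := by
    rintro rfl
    simp at hx
  have step : ∀ k, zigzag (k + 1) - zigzag k = k + 1 ∨ zigzag k - zigzag (k + 1) = k + 1 := by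
    intro k
    unfold zigzag
    split_ifs <;> omega
  rcases lt_trichotomy a t with h | h | h
  · right
    obtain ⟨k, rfl⟩ : ∃ k, a = k + 1 := ⟨a - 1, by omega⟩
    refine ⟨k, h, ?_⟩
    rcases step k with hk | hk
    · left
      exact_mod_cast (congrArg (Int.cast : ℤ → ZMod (2 * t)) hk).symm
    · right
      exact_mod_cast (congrArg (Int.cast : ℤ → ZMod (2 * t)) hk).symm
  · exact Or.inl (by rw [h])
  · right
    obtain ⟨k, hk⟩ : ∃ k, 2 * t = a + (k + 1) := ⟨2 * t - a - 1, by omega⟩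
    refine ⟨k, by omega, ?_⟩
    have hcast := congrArg (Nat.cast : ℕ → ZMod (2 * t)) hk
    push_cast at hcast
    rcases step k with hk | hk
    · right
      have := congrArg (Int.cast : ℤ → ZMod (2 * t)) hk
      push_cast at this
      linear_combination natCast_add_self t - hcast + this
    · left
      have := congrArg (Int.cast : ℤ → ZMod (2 * t)) hk
      push_cast at this
      linear_combination natCast_add_self t - hcast + this

/-- The edges on the positions `1, …, 4 * t ^ 2 + 1`, smaller position first. Block `m` occupies
the positions `4 * t * m + 1, …, 4 * t * m + 4 * t` and consists of a quadrilateral on the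
positions divisible by `t`, with one diagonal and a fan attached to each side. -/
def Edge (t p q : ℕ) : Prop :=
  q = p + 1 ∨ ∃ m x y, p = 4 * t * m + x ∧ q = 4 * t * m + y ∧ 1 ≤ x ∧ x < y ∧
    ((y = t) ∨ (t ≤ x ∧ y = 2 * t) ∨ (2 * t ≤ x ∧ y = 3 * t) ∨ (3 * t ≤ x ∧ y = 4 * t) ∨
      (x = 1 ∧ y = 4 * t) ∨ (x = t ∧ y = 4 * t) ∨ (x = t ∧ y = 3 * t))

theorem Edge.lt {t p q : ℕ} (h : Edge t p q) : p < q := by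
  rcases h with rfl | ⟨m, x, y, rfl, rfl, -, h, -⟩ <;> omega

theorem Edge.noncrossing {t a b c d : ℕ} (h : Edge t a b) (h' : Edge t c d) (hac : a < c)
    (hcb : c < b) (hbd : b < d) : False := by
  rcases h with rfl | ⟨m, x, y, rfl, rfl, hx, hxy, h⟩
  · omega
  rcases h' with rfl | ⟨m', x', y', rfl, rfl, hx', hxy', h'⟩
  · omega
  rcases lt_trichotomy m m' with hm | rfl | hm
  · have := Nat.mul_le_mul_left (4 * t) (Nat.succ_le_of_lt hm)
    rw [Nat.succ_eq_add_one, mul_add, mul_one] at this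
    omega
  · generalize 4 * t * m = B at hac hcb hbd
    omega
  · have := Nat.mul_le_mul_left (4 * t) (Nat.succ_le_of_lt hm)
    rw [Nat.succ_eq_add_one, mul_add, mul_one] at this
    omega

/-- The center of block `m`. -/
def center (t m : ℕ) : ZMod (2 * t) := m * (t - 1)

/-- The color of a position; the colors are two copies of `ZMod (2 * t)`. -/
def color (t p : ℕ) : ZMod (2 * t) × Bool :=
  if p = 4 * t * t + 1 then (center t t + 1, false)
  else
    let i := center t (p / (4 * t))
    let r := p % (4 * t)
    let k := zigzag (r % t)
    if r = 0 then (i + t + 1, false)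
    else if r < t then (i - k, false)
    else if r < 2 * t then (i + k, true)
    else if r < 3 * t then (i + t - k, false)
    else (i + t + k, true)

theorem color_block {t m r : ℕ} (hm : m < t) (hr : r < 4 * t) (hr0 : r ≠ 0) :
    color t (4 * t * m + r) =
      if r < t then (center t m - zigzag (r % t), false)
      else if r < 2 * t then (center t m + zigzag (r % t), true)
      else if r < 3 * t then (center t m + t - zigzag (r % t), false)
      else (center t m + t + zigzag (r % t), true) := by
  have h1 : (4 * t * m + r) / (4 * t) = m := by
    rw [Nat.mul_add_div (by omega), Nat.div_eq_of_lt hr, add_zero]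
  have h2 : (4 * t * m + r) % (4 * t) = r := by
    rw [Nat.mul_add_mod, Nat.mod_eq_of_lt hr]
  have h3 : 4 * t * m + r ≠ 4 * t * t + 1 := by
    have := Nat.mul_le_mul_left (4 * t) (Nat.succ_le_of_lt hm)
    rw [Nat.succ_eq_add_one, mul_add, mul_one] at this
    omega
  simp only [color, h1, h2, h3, hr0, if_false]

theorem color_block_end {t m : ℕ} (hm : m < t) :
    color t (4 * t * m + 4 * t) = (center t m, false) := by
  have h0 : 4 * t * m + 4 * t = 4 * t * (m + 1) := by ring
  have h1 : 4 * t * (m + 1) / (4 * t) = m + 1 := Nat.mul_div_cancel_left _ (by omega)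
  have h3 : 4 * t * (m + 1) ≠ 4 * t * t + 1 := by
    have := Nat.mul_le_mul_left (4 * t) (Nat.succ_le_of_lt hm)
    rw [Nat.succ_eq_add_one] at this
    omega
  rw [h0]
  simp only [color, h1, h3, if_false, Nat.mul_mod_right, if_true, Prod.mk.injEq, and_true]
  simp only [center]
  push_cast
  linear_combination natCast_add_self t

theorem color_last (t : ℕ) : color t (4 * t * t + 1) = (center t t + 1, false) := by
  simp [color]

theorem zigzag_zero : zigzag 0 = 0 := rfl

theorem zigzag_one : zigzag 1 = -1 := rfl

theorem color_segment_zero {t m k : ℕ} (hm : m < t) (hk : k < t) (hk0 : k ≠ 0) :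
    color t (4 * t * m + k) = (center t m - zigzag k, false) := by
  rw [color_block hm (by omega) hk0, if_pos hk, Nat.mod_eq_of_lt hk]

theorem color_segment_one {t m k : ℕ} (hm : m < t) (hk : k < t) :
    color t (4 * t * m + (t + k)) = (center t m + zigzag k, true) := by
  rw [color_block hm (by omega) (by omega), if_neg (by omega), if_pos (by omega),
    Nat.add_mod_left, Nat.mod_eq_of_lt hk]

theorem color_segment_two {t m k : ℕ} (hm : m < t) (hk : k < t) :
    color t (4 * t * m + (2 * t + k)) = (center t m + t - zigzag k, false) := by
  rw [color_block hm (by omega) (by omega), if_neg (by omega), if_neg (by omega),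
    if_pos (by omega), Nat.mul_add_mod_self_right, Nat.mod_eq_of_lt hk]

theorem color_segment_three {t m k : ℕ} (hm : m < t) (hk : k < t) :
    color t (4 * t * m + (3 * t + k)) = (center t m + t + zigzag k, true) := by
  rw [color_block hm (by omega) (by omega), if_neg (by omega), if_neg (by omega),
    if_neg (by omega), Nat.mul_add_mod_self_right, Nat.mod_eq_of_lt hk]

/-- Some edge has the end colors `a` and `b`. -/
def Joined (t : ℕ) (a b : ZMod (2 * t) × Bool) : Prop :=
  ∃ p q, 1 ≤ p ∧ 1 ≤ q ∧ p ≤ 4 * t ^ 2 + 1 ∧ q ≤ 4 * t ^ 2 + 1 ∧ (Edge t p q ∨ Edge t q p) ∧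
    color t p = a ∧ color t q = b

theorem Joined.symm {t : ℕ} {a b : ZMod (2 * t) × Bool} (h : Joined t a b) : Joined t b a := by
  obtain ⟨p, q, hp, hq, hp', hq', h, hc, hc'⟩ := h
  exact ⟨q, p, hq, hp, hq', hp', h.symm, hc', hc⟩

theorem joined_of_edge {t m x y : ℕ} (hm : m < t) (hx : 1 ≤ x) (hy : y ≤ 4 * t)
    (h : Edge t (4 * t * m + x) (4 * t * m + y)) :
    Joined t (color t (4 * t * m + x)) (color t (4 * t * m + y)) := by
  have hlt := h.lt
  have := Nat.mul_le_mul_left (4 * t) (Nat.succ_le_of_lt hm)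
  rw [Nat.succ_eq_add_one, mul_add, mul_one, mul_assoc 4 t t, ← pow_two] at this
  exact ⟨_, _, by omega, by omega, by omega, by omega, Or.inl h, rfl, rfl⟩

theorem exists_center_eq {t : ℕ} (ht : 1 ≤ t) (x : ZMod (2 * t)) :
    ∃ m < t, x = center t m ∨ x = center t m + t := by
  have : NeZero (2 * t) := ⟨by omega⟩
  obtain ⟨a, ha, hx⟩ : ∃ a : ℕ, a < 2 * t ∧ (a : ZMod (2 * t)) = -x :=
    ⟨(-x).val, (-x).val_lt, ZMod.natCast_zmod_val _⟩
  have key : ∀ m : ℕ, center t m = -m ∨ center t m = -m + t := by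
    intro m
    obtain ⟨l, rfl | rfl⟩ := m.even_or_odd'
    · left
      simp only [center]
      push_cast
      linear_combination (l : ZMod (2 * t)) * natCast_add_self t
    · right
      simp only [center]
      push_cast
      linear_combination (l : ZMod (2 * t)) * natCast_add_self t
  rcases lt_or_ge a t with h | h
  · refine ⟨a, h, (key a).imp (fun e => ?_) (fun e => ?_)⟩
    · linear_combination hx - e
    · linear_combination hx - e - natCast_add_self t
  · obtain ⟨b, rfl⟩ := Nat.exists_eq_add_of_le h
    push_cast at hx
    refine ⟨b, by omega, (key b).symm.imp (fun e => ?_) (fun e => ?_)⟩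
    · linear_combination hx - e - natCast_add_self t
    · linear_combination hx - e - natCast_add_self t

variable {t : ℕ}

theorem joined_true_step (ht : 1 ≤ t) (x : ZMod (2 * t)) {k : ℕ} (hk : k + 1 < t) :
    Joined t (x + zigzag k, true) (x + zigzag (k + 1), true) := by
  obtain ⟨m, hm, rfl | rfl⟩ := exists_center_eq ht x
  · rw [← color_segment_one hm (by omega), ← color_segment_one hm hk]
    exact joined_of_edge hm (by omega) (by omega) (Or.inl (by omega))
  · rw [← color_segment_three hm (by omega), ← color_segment_three hm hk]
    exact joined_of_edge hm (by omega) (by omega) (Or.inl (by omega))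

theorem joined_false_step (ht : 1 ≤ t) (x : ZMod (2 * t)) {k : ℕ} (hk : k + 1 < t) :
    Joined t (x - zigzag k, false) (x - zigzag (k + 1), false) := by
  obtain ⟨m, hm, rfl | rfl⟩ := exists_center_eq ht x
  · rw [← color_segment_zero hm hk (by omega)]
    rcases eq_or_ne k 0 with rfl | hk0
    · rw [zigzag_zero, Int.cast_zero, sub_zero, ← color_block_end hm]
      exact (joined_of_edge hm (by omega) le_rfl
        (Or.inr ⟨m, 1, 4 * t, rfl, rfl, by omega⟩)).symm
    · rw [← color_segment_zero hm (by omega) hk0]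
      exact joined_of_edge hm (by omega) (by omega) (Or.inl (by omega))
  · rw [← color_segment_two hm (by omega), ← color_segment_two hm hk]
    exact joined_of_edge hm (by omega) (by omega) (Or.inl (by omega))

theorem joined_false_fan (ht : 1 ≤ t) (x : ZMod (2 * t)) {k : ℕ} (hk : k < t) :
    Joined t (x - zigzag k, false) (x, true) := by
  obtain ⟨m, hm, rfl | rfl⟩ := exists_center_eq ht x
  · have h1 := color_segment_one hm (k := 0) (by omega)
    rw [zigzag_zero, Int.cast_zero, add_zero, add_zero] at h1
    rw [← h1]
    rcases eq_or_ne k 0 with rfl | hk0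
    · rw [zigzag_zero, Int.cast_zero, sub_zero, ← color_block_end hm]
      exact (joined_of_edge hm (by omega) le_rfl
        (Or.inr ⟨m, t, 4 * t, rfl, rfl, by omega⟩)).symm
    · rw [← color_segment_zero hm hk hk0]
      exact joined_of_edge hm (by omega) (by omega) (Or.inr ⟨m, k, t, rfl, rfl, by omega⟩)
  · have h1 := color_segment_three hm (k := 0) (by omega)
    rw [zigzag_zero, Int.cast_zero, add_zero, add_zero] at h1
    rw [← h1, ← color_segment_two hm hk]
    exact joined_of_edge hm (by omega) (by omega)
      (Or.inr ⟨m, 2 * t + k, 3 * t, rfl, rfl, by omega⟩)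

theorem joined_true_fan (ht : 1 ≤ t) (x : ZMod (2 * t)) {k : ℕ} (hk : k < t) :
    Joined t (x + zigzag k, true) (x + t, false) := by
  obtain ⟨m, hm, rfl | rfl⟩ := exists_center_eq ht x
  · have h1 := color_segment_two hm (k := 0) (by omega)
    rw [zigzag_zero, Int.cast_zero, sub_zero, add_zero] at h1
    rw [← h1, ← color_segment_one hm hk]
    exact joined_of_edge hm (by omega) (by omega)
      (Or.inr ⟨m, t + k, 2 * t, rfl, rfl, by omega⟩)
  · rw [add_assoc (center t m) (t : ZMod (2 * t)) t, natCast_add_self, add_zero,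
      ← color_block_end hm, ← color_segment_three hm hk]
    exact joined_of_edge hm (by omega) (by omega)
      (Or.inr ⟨m, 3 * t + k, 4 * t, rfl, rfl, by omega⟩)

theorem joined_true_antipodal (ht : 1 ≤ t) (x : ZMod (2 * t)) :
    Joined t (x, true) (x + t, true) := by
  have key : ∀ m < t, Joined t (center t m, true) (center t m + t, true) := by
    intro m hm
    have h1 := color_segment_one hm (k := 0) (by omega)
    have h3 := color_segment_three hm (k := 0) (by omega)
    rw [zigzag_zero, Int.cast_zero, add_zero, add_zero] at h1 h3
    rw [← h1, ← h3]
    exact joined_of_edge hm (by omega) (by omega) (Or.inr ⟨m, t, 3 * t, rfl, rfl, by omega⟩)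
  obtain ⟨m, hm, rfl | rfl⟩ := exists_center_eq ht x
  · exact key m hm
  · rw [add_assoc, natCast_add_self, add_zero]
    exact (key m hm).symm

theorem color_block_start {m : ℕ} (hm : m < t) :
    color t (4 * t * m + 4 * t + 1) = (center t m + t, false) := by
  have hcenter : center t (m + 1) + 1 = center t m + t := by
    simp only [center]
    push_cast
    ring
  have h0 : 4 * t * m + 4 * t + 1 = 4 * t * (m + 1) + 1 := by ring
  rw [h0, ← hcenter]
  rcases eq_or_ne (m + 1) t with h | h
  · rw [h, color_last]
  · rw [color_segment_zero (by omega) (by omega) one_ne_zero, zigzag_one]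
    simp

theorem joined_false_antipodal (ht : 1 ≤ t) (x : ZMod (2 * t)) :
    Joined t (x, false) (x + t, false) := by
  have key : ∀ m < t, Joined t (center t m, false) (center t m + t, false) := by
    intro m hm
    have := Nat.mul_le_mul_left (4 * t) (Nat.succ_le_of_lt hm)
    rw [Nat.succ_eq_add_one, mul_add, mul_one, mul_assoc 4 t t, ← pow_two] at this
    exact ⟨_, _, by omega, by omega, by omega, by omega, Or.inl (Or.inl rfl),
      color_block_end hm, color_block_start hm⟩
  obtain ⟨m, hm, rfl | rfl⟩ := exists_center_eq ht x
  · exact key m hm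
  · rw [add_assoc, natCast_add_self, add_zero]
    exact (key m hm).symm

theorem joined_true_true (ht : 1 ≤ t) {x y : ZMod (2 * t)} (hxy : x ≠ y) :
    Joined t (x, true) (y, true) := by
  rcases exists_zigzag_step ht (sub_ne_zero.2 hxy.symm) with h | ⟨k, hk, h | h⟩
  · rw [eq_add_of_sub_eq' h]
    exact joined_true_antipodal ht x
  · convert joined_true_step ht (x - zigzag k) hk using 2
    · ring
    · linear_combination h
  · convert (joined_true_step ht (y - zigzag k) hk).symm using 2
    · linear_combination -h
    · ring

theorem joined_false_false (ht : 1 ≤ t) {x y : ZMod (2 * t)} (hxy : x ≠ y) :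
    Joined t (x, false) (y, false) := by
  rcases exists_zigzag_step ht (sub_ne_zero.2 hxy.symm) with h | ⟨k, hk, h | h⟩
  · rw [eq_add_of_sub_eq' h]
    exact joined_false_antipodal ht x
  · convert (joined_false_step ht (y + zigzag k) hk).symm using 2
    · linear_combination -h
    · ring
  · convert joined_false_step ht (x + zigzag k) hk using 2
    · ring
    · linear_combination h

theorem joined_true_false (ht : 1 ≤ t) (x y : ZMod (2 * t)) :
    Joined t (x, true) (y, false) := by
  obtain ⟨k, hk, h | h⟩ := exists_zigzag_eq ht (x - y)
  · convert (joined_false_fan ht x hk).symm using 2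
    linear_combination -h
  · convert joined_true_fan ht (y + t) hk using 2
    · linear_combination h
    · rw [add_assoc, natCast_add_self, add_zero]

theorem joined_of_ne (ht : 1 ≤ t) {a b : ZMod (2 * t) × Bool} (hab : a ≠ b) :
    Joined t a b := by
  obtain ⟨x, _ | _⟩ := a <;> obtain ⟨y, _ | _⟩ := b
  · exact joined_false_false ht fun h => hab (by rw [h])
  · exact (joined_true_false ht y x).symm
  · exact joined_true_false ht x y
  · exact joined_true_true ht fun h => hab (by rw [h])

/-- The graph formed by the blocks, with vertices numbered from `0`. -/
def graph (t n : ℕ) : SimpleGraph (Fin n) where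
  Adj u v := Edge t (u + 1) (v + 1) ∨ Edge t (v + 1) (u + 1)
  symm := ⟨fun _ _ h => h.symm⟩
  loopless := ⟨fun _ h => by rcases h with h | h <;> exact lt_irrefl _ h.lt⟩

theorem graph_isNoncrossing (t n : ℕ) : (graph t n).IsNoncrossing := by
  intro a b c d hab hcd hac hcb hbd
  have hab' : Edge t (a + 1) (b + 1) := hab.resolve_right fun h => by
    have := h.lt
    omega
  have hcd' : Edge t (c + 1) (d + 1) := hcd.resolve_right fun h => by
    have := h.lt
    omega
  exact hab'.noncrossing hcd' (by omega) (by omega) (by omega)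

end FanBlocks

theorem floor_sqrt_four_mul_sub (t : ℕ) (ht : 1 ≤ t) :
    ⌊Real.sqrt (4 * (4 * t ^ 2 + 1 : ℕ) - 23 / 4) + 1 / 2⌋ = 4 * (t : ℤ) := by
  have ht' : (1 : ℝ) ≤ t := by exact_mod_cast ht
  rw [Int.floor_eq_iff]
  push_cast
  constructor
  · have : 4 * (t : ℝ) - 1 / 2 ≤ Real.sqrt (4 * (4 * t ^ 2 + 1) - 23 / 4) :=
      Real.le_sqrt_of_sq_le (by nlinarith)
    linarith
  · have : Real.sqrt (4 * (4 * (t : ℝ) ^ 2 + 1) - 23 / 4) < 4 * t + 1 / 2 := by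
      rw [Real.sqrt_lt' (by linarith)]
      nlinarith
    linarith

/-- For `t ≥ 1` and `n = 4t² + 1`, there exists an outerplanar graph `G` of order `n`
with `ψ(G) = ψ_s(G) = ⌊√(4n − 23/4) + 1/2⌋ = 4t`. -/
theorem exists_outerplanar_achromatic_eq (t n : ℕ) (ht : 1 ≤ t)
    (hn : n = 4 * t ^ 2 + 1) :
    ∃ G : SimpleGraph (Fin n), G.IsOuterplanar ∧
      G.achromatic = 4 * t ∧ G.pseudoachromatic = 4 * t ∧
      ⌊Real.sqrt (4 * n - 23 / 4) + 1 / 2⌋ = 4 * (t : ℤ) := by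
  have : NeZero (2 * t) := ⟨by omega⟩
  have hcard : Fintype.card (ZMod (2 * t) × Bool) = 4 * t := by
    rw [Fintype.card_prod, ZMod.card, Fintype.card_bool]
    ring
  let φ := Fintype.equivFinOfCardEq hcard
  obtain ⟨G, hle, hG, hG'⟩ := SimpleGraph.exists_le_achromatic_eq (H := FanBlocks.graph t n)
    (k := 4 * t) (by omega) (c := fun v => φ (FanBlocks.color t (v + 1))) (by
      intro i j hij
      obtain ⟨p, q, hp, hq, hp', hq', h, hcp, hcq⟩ :=
        FanBlocks.joined_of_ne ht (φ.symm.injective.ne hij)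
      obtain ⟨p, rfl⟩ := Nat.exists_eq_add_of_le' hp
      obtain ⟨q, rfl⟩ := Nat.exists_eq_add_of_le' hq
      exact ⟨⟨p, by omega⟩, ⟨q, by omega⟩, h, by simp [hcp], by simp [hcq]⟩)
  have hnc : G.IsNoncrossing := fun a b c d hab hcd =>
    FanBlocks.graph_isNoncrossing t n (hle hab) (hle hcd)
  refine ⟨G, hnc.isOuterplanar, hG, hG', ?_⟩
  rw [hn]
  exact floor_sqrt_four_mul_sub t ht
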